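/- arXiv:2504.08667 — 2 statements merged into one kernel-verified Lean document; each statement's English description precedes it below -/
import Mathlib

section
/- Let G = (V, E, s) be a graph in which every node is reachable from s. For every node a ∈ V and every j with 1 ≤ j ≤ k_a, every arc (x, y) ∈ E with y ∈ D(S^a_j) and x ∉ D(S^a_j) satisfies x ∈ {a} ∪ ⋃_{i=1}^{j-1} D(S^a_i). -/
open Relation

variable {V : Type*}

/-- `p` is a path from `a` to `b` in the arc relation `E`:
a nonempty list of nodes starting at `a`, ending at `b`,
in which every consecutive pair of nodes is an arc. -/
def IsPath (E : V → V → Prop) (a b : V) (p : List V) : Prop :=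
  p ≠ [] ∧ p.head? = some a ∧ p.getLast? = some b ∧ p.Chain' E

/-- `a` dominates `b` (written `a ≥_s b`): every path from `s` to `b` contains `a`. -/
def Dom (E : V → V → Prop) (s a b : V) : Prop :=
  ∀ p : List V, IsPath E s b p → a ∈ p

/-- `m` is a source of module `M`: `m ∈ M`, every arc entering `M` from outside goes
to `m`, and (convention) if `s ∈ M` then `m = s`. -/
def ModuleSource (E : V → V → Prop) (s : V) (M : Set V) (m : V) : Prop :=
  m ∈ M ∧ (∀ u v, E u v → u ∉ M → v ∈ M → v = m) ∧ (s ∈ M → m = s)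

/-- `M` is a module of the graph `(V, E, s)`. -/
def IsModule (E : V → V → Prop) (s : V) (M : Set V) : Prop :=
  ∃ m, ModuleSource E s M m

/-- Two sets overlap: they intersect but neither contains the other. -/
def Overlap (M H : Set V) : Prop :=
  (M ∩ H).Nonempty ∧ ¬ M ⊆ H ∧ ¬ H ⊆ M

/-- A nesting decomposition: a collection of pairwise non-overlapping modules
containing the trivial modules (the whole node set and all singletons). -/
def IsNestingDecomp (E : V → V → Prop) (s : V) (F : Set (Set V)) : Prop :=
  (∀ M ∈ F, IsModule E s M) ∧
  (∀ M ∈ F, ∀ H ∈ F, ¬ Overlap M H) ∧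
  (Set.univ : Set V) ∈ F ∧
  (∀ v : V, ({v} : Set V) ∈ F)

/-- The maximal module partition of `M` within the family `F`. -/
def MaxPartition (F : Set (Set V)) (M : Set V) : Set (Set V) :=
  {H | H ∈ F ∧ H ⊂ M ∧ ¬ ∃ K ∈ F, H ⊂ K ∧ K ⊂ M}

/-- The width of a nesting decomposition `F`. -/
noncomputable def NDWidth (F : Set (Set V)) : ℕ :=
  ⨆ M ∈ F, (MaxPartition F M).ncard

/-- The nesting width of the graph `(V, E, s)`. -/
noncomputable def nestingWidth (E : V → V → Prop) (s : V) : ℕ :=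
  sInf {w : ℕ | ∃ F : Set (Set V), IsNestingDecomp E s F ∧ NDWidth F = w}

/-- `D(a)`: the set of nodes dominated by `a`. -/
def DomSet (E : V → V → Prop) (s a : V) : Set V := {v | Dom E s a v}

/-- `v` is a child of `a` in the dominator tree. -/
def IsChild (E : V → V → Prop) (s a v : V) : Prop :=
  v ≠ a ∧ Dom E s a v ∧ ∀ b, b ≠ a → b ≠ v → ¬(Dom E s a b ∧ Dom E s b v)

/-- `C(a)`: the set of children of `a` in the dominator tree. -/
def Children (E : V → V → Prop) (s a : V) : Set V := {v | IsChild E s a v}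

/-- The arc relation of the graph `G_a` on the children of `a`. -/
def GArc (E : V → V → Prop) (s a : V) (u v : V) : Prop :=
  u ∈ Children E s a ∧ v ∈ Children E s a ∧ u ≠ v ∧
    ∃ x y, E x y ∧ x ∈ DomSet E s u ∧ y ∈ DomSet E s v

/-- `S` is a strongly connected component of `G_a`
(an equivalence class of mutual reachability in `G_a`). -/
def IsSCC (E : V → V → Prop) (s a : V) (S : Set V) : Prop :=
  ∃ u ∈ Children E s a,
    S = {v | v ∈ Children E s a ∧ ReflTransGen (GArc E s a) u v ∧
          ReflTransGen (GArc E s a) v u}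

/-- `L` lists the strongly connected components of `G_a` in topological order:
each member is an SCC of `G_a`, every child of `a` lies in exactly one listed
component, and every arc of `G_a` goes from an earlier component to the same
or a later component. -/
def IsTopoSCCList (E : V → V → Prop) (s a : V) (L : List (Set V)) : Prop :=
  (∀ S ∈ L, IsSCC E s a S) ∧
  (∀ v ∈ Children E s a, ∃! i : Fin L.length, v ∈ L.get i) ∧
  (∀ i j : Fin L.length, ∀ u ∈ L.get i, ∀ v ∈ L.get j, GArc E s a u v → i ≤ j)

/-- `D(S) = ⋃_{v ∈ S} D(v)`. -/
def DSet (E : V → V → Prop) (s : V) (S : Set V) : Set V := ⋃ v ∈ S, DomSet E s v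

/-- The set `{a} ∪ ⋃_{i=1}^{j} D(S^a_i)` (components indexed from 0 in the list). -/
def PrefixModule (E : V → V → Prop) (s a : V) (L : List (Set V)) (j : ℕ) : Set V :=
  {a} ∪ ⋃ i ∈ Finset.range j, DSet E s (L.getD i ∅)

/-- The A-C family determined by a choice `L` of topologically ordered SCC lists. -/
def ACFamily (E : V → V → Prop) (s : V) (L : V → List (Set V)) : Set (Set V) :=
  {M | ∃ (a : V) (j : ℕ), j ≤ (L a).length ∧ M = PrefixModule E s a (L a) j}

/-- The quantity `max { |S^a_i| : a ∈ V, 1 ≤ i ≤ k_a }`. -/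
noncomputable def MaxSCCSize (L : V → List (Set V)) : ℕ :=
  ⨆ a : V, ⨆ i ∈ Finset.range (L a).length, ((L a).getD i ∅).ncard

theorem IsPath.concat {E : V → V → Prop} {s x y : V} {p : List V} (hp : IsPath E s x p)
    (hxy : E x y) : IsPath E s y (p ++ [y]) := by
  obtain ⟨hne, hh, hl, hc⟩ := hp
  refine ⟨by simp, by simp [List.head?_append, hh], by simp, ?_⟩
  refine List.isChain_append.2 ⟨hc, List.isChain_singleton y, ?_⟩
  intro u hu w hw
  simp_all

/-- A path through `c` has an initial segment that is a path to `c`. -/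
theorem IsPath.exists_prefix {E : V → V → Prop} {s b c : V} {p : List V} (hp : IsPath E s b p)
    (hc : c ∈ p) :
    ∃ q, IsPath E s c q ∧ q ⊆ p ∧ (c ≠ b → q.length < p.length) := by
  obtain ⟨l₁, l₂, rfl⟩ := List.append_of_mem hc
  obtain ⟨-, hh, hl, hch⟩ := hp
  refine ⟨l₁ ++ [c], ⟨by simp, ?_, by simp, ?_⟩, ?_, ?_⟩
  · simpa [List.head?_append] using hh
  · have h : l₁ ++ c :: l₂ = (l₁ ++ [c]) ++ l₂ := by simp
    rw [h] at hch
    exact (List.isChain_append.1 hch).1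
  · intro z hz
    simp at hz ⊢
    tauto
  · intro hcb
    cases l₂ with
    | nil => exact absurd (by simpa using hl) hcb
    | cons _ _ => simp

theorem Dom.trans {E : V → V → Prop} {s a b c : V} (hab : Dom E s a b) (hbc : Dom E s b c) :
    Dom E s a c := by
  intro p hp
  obtain ⟨q, hq, hqp, -⟩ := hp.exists_prefix (hbc p hp)
  exact hqp (hab q hq)

theorem Dom.refl (E : V → V → Prop) (s a : V) : Dom E s a a :=
  fun _ hp => List.mem_of_getLast? hp.2.2.1

theorem Dom.antisymm {E : V → V → Prop} {s a b : V} (hreach : ∃ p, IsPath E s b p)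
    (hab : Dom E s a b) (hba : Dom E s b a) : a = b := by
  by_contra hne
  have no_path : ∀ n, ∀ p, p.length = n → ¬ IsPath E s b p := by
    intro n
    induction n using Nat.strong_induction_on with
    | _ n ih =>
      rintro p rfl hp
      obtain ⟨q, hq, -, hqlt⟩ := hp.exists_prefix (hab p hp)
      obtain ⟨r, hr, -, hrlt⟩ := hq.exists_prefix (hba q hq)
      exact ih _ ((hrlt (Ne.symm hne)).trans (hqlt hne)) r rfl hr
  obtain ⟨p, hp⟩ := hreach
  exact no_path _ p rfl hp

/-- Every node properly dominated by `a` is dominated by a child of `a`. -/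
theorem exists_child_dom [Finite V] {E : V → V → Prop} {s : V}
    (hreach : ∀ v : V, ∃ p : List V, IsPath E s v p) {a x : V} (hax : Dom E s a x)
    (hne : x ≠ a) : ∃ u ∈ Children E s a, Dom E s u x := by
  obtain ⟨u, ⟨hua, hau, hux⟩, hmax⟩ :=
    Set.exists_max_image {b | b ≠ a ∧ Dom E s a b ∧ Dom E s b x}
      (fun b => (DomSet E s b).ncard) (Set.toFinite _) ⟨x, hne, hax, Dom.refl E s x⟩
  refine ⟨u, ⟨hua, hau, ?_⟩, hux⟩
  rintro c hca hcu ⟨hac, hcu'⟩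
  refine (hmax c ⟨hca, hac, hcu'.trans hux⟩).not_gt (Set.ncard_lt_ncard ?_ (Set.toFinite _))
  exact ⟨fun z hz => hcu'.trans hz,
    fun h => hcu (Dom.antisymm (hreach u) hcu' (h (Dom.refl E s c)))⟩

/-- An arc entering `D(v)` from outside ends at `v`. -/
theorem eq_of_arc_into_domSet {E : V → V → Prop} {s v x y : V} (hxy : E x y)
    (hy : Dom E s v y) (hx : ¬ Dom E s v x) : y = v := by
  simp only [Dom, not_forall] at hx
  obtain ⟨p, hp, hvp⟩ := hx
  have h := hy _ (hp.concat hxy)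
  simp only [List.mem_append, List.mem_singleton, hvp, false_or] at h
  exact h.symm

/-- A proper dominator of `v` dominates every predecessor of `v`. -/
theorem Dom.of_arc {E : V → V → Prop} {s a v x : V} (hav : Dom E s a v) (hne : a ≠ v)
    (hxv : E x v) : Dom E s a x := by
  intro p hp
  have h := hav _ (hp.concat hxv)
  simpa [hne] using h

/-- for `1 ≤ j ≤ k_a`, every arc `(x,y)` with `y ∈ D(S^a_j)` and
`x ∉ D(S^a_j)` has `x ∈ {a} ∪ ⋃_{i=1}^{j-1} D(S^a_i)`.
(The list `L` indexes the components from 0, so `S^a_j` is `L.getD (j-1) ∅`.) -/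
theorem arcs_into_component [Fintype V] (E : V → V → Prop) (s : V)
    (hreach : ∀ v : V, ∃ p : List V, IsPath E s v p)
    (a : V) (L : List (Set V)) (hL : IsTopoSCCList E s a L)
    (j : ℕ) (hj1 : 1 ≤ j) (hj : j ≤ L.length)
    (x y : V) (hxy : E x y)
    (hy : y ∈ DSet E s (L.getD (j - 1) ∅))
    (hx : x ∉ DSet E s (L.getD (j - 1) ∅)) :
    x ∈ PrefixModule E s a L (j - 1) := by
  obtain ⟨k, rfl⟩ : ∃ k, j = k + 1 := ⟨j - 1, by omega⟩
  simp only [Nat.add_sub_cancel] at hy hx ⊢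
  have hk : k < L.length := by omega
  rw [List.getD_eq_getElem _ _ hk] at hy hx
  obtain ⟨hscc, hpart, htopo⟩ := hL
  simp only [DSet, Set.mem_iUnion, DomSet, Set.mem_ofPred_eq, exists_prop, not_exists,
    not_and] at hy hx
  obtain ⟨v, hvS, hvy⟩ := hy
  have hvx := hx v hvS
  obtain rfl := eq_of_arc_into_domSet hxy hvy hvx
  have hyC : y ∈ Children E s a := by
    obtain ⟨w, -, hw⟩ := hscc _ (List.getElem_mem hk)
    rw [hw] at hvS
    exact hvS.1
  by_cases hxa : x = a
  · exact Or.inl hxa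
  obtain ⟨u, huC, hux⟩ := exists_child_dom hreach (hyC.2.1.of_arc hyC.1.symm hxy) hxa
  obtain ⟨i, hi, -⟩ := hpart u huC
  have huy : u ≠ y := by
    rintro rfl
    exact hvx hux
  have hik : i ≤ ⟨k, hk⟩ :=
    htopo i ⟨k, hk⟩ u hi y hvS ⟨huC, hyC, huy, x, y, hxy, hux, Dom.refl E s y⟩
  have hne : (i : ℕ) ≠ k := by
    rintro rfl
    exact hx u hi hux
  refine Or.inr (Set.mem_biUnion (x := (i : ℕ)) ?_ ?_)
  · simpa using lt_of_le_of_ne (Fin.le_def.1 hik) hne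
  · rw [List.getD_eq_getElem _ _ i.2]
    exact Set.mem_biUnion hi hux
end

section
/- Let G = (V, E, s) be a graph in which every node is reachable from s, with |V| ≥ 2, and suppose the arc relation E admits no directed cycle. Then the nesting width of G satisfies nw(G) ≤ 2. -/
open Relation

variable {V : Type*}

theorem IsPath.reflTransGen {E : V → V → Prop} {a b : V} {p : List V} (h : IsPath E a b p) :
    ReflTransGen E a b := by
  obtain ⟨hne, hhead, hlast, hchain⟩ := h
  induction p generalizing a with
  | nil => exact absurd rfl hne
  | cons x l ih =>
    obtain rfl : x = a := by simpa using hhead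
    cases l with
    | nil =>
      obtain rfl : x = b := by simpa using hlast
      exact .refl
    | cons y l =>
      have hc : E x y ∧ List.IsChain E (y :: l) := List.isChain_cons_cons.1 hchain
      exact .head hc.1 (ih (by simp) (by simp) (by simpa using hlast) hc.2)

theorem isModule_singleton (E : V → V → Prop) (s v : V) : IsModule E s {v} :=
  ⟨v, rfl, fun _ _ _ _ h => h, fun h => h.symm⟩

theorem not_overlap_singleton_left (v : V) (H : Set V) : ¬ Overlap {v} H := by
  rintro ⟨⟨x, rfl, hx⟩, h, -⟩
  exact h (Set.singleton_subset_iff.2 hx)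

theorem not_overlap_singleton_right (v : V) (M : Set V) : ¬ Overlap M {v} := by
  rintro ⟨⟨x, hx, rfl⟩, -, h⟩
  exact h (Set.singleton_subset_iff.2 hx)

/-- The singletons together with the initial segments of a linear order. -/
def initialSegments (V : Type*) [LinearOrder V] : Set (Set V) :=
  Set.range (fun v : V => ({v} : Set V)) ∪ Set.range Set.Iic

section LinearOrder

variable [LinearOrder V]

theorem isNestingDecomp_initialSegments [Finite V] {E : V → V → Prop} {s : V}
    (hE : ∀ u v, E u v → u ≤ v) (hs : ∀ v, s ≤ v) :
    IsNestingDecomp E s (initialSegments V) := by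
  refine ⟨?_, ?_, ?_, fun v => .inl ⟨v, rfl⟩⟩
  · rintro _ (⟨v, rfl⟩ | ⟨a, rfl⟩)
    · exact isModule_singleton E s v
    · exact ⟨s, hs a, fun u v huv hu hv => absurd ((hE u v huv).trans hv) hu, fun _ => rfl⟩
  · rintro _ (⟨v, rfl⟩ | ⟨a, rfl⟩) _ (⟨w, rfl⟩ | ⟨b, rfl⟩)
    · exact not_overlap_singleton_left _ _
    · exact not_overlap_singleton_left _ _
    · exact not_overlap_singleton_right _ _
    · rintro ⟨-, h₁, h₂⟩
      rcases le_total a b with h | h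
      · exact h₁ (Set.Iic_subset_Iic.2 h)
      · exact h₂ (Set.Iic_subset_Iic.2 h)
  · have : Nonempty V := ⟨s⟩
    obtain ⟨t, ht⟩ := Finite.exists_max (id : V → V)
    exact .inr ⟨t, Set.eq_univ_of_forall ht⟩

theorem eq_Iic_of_mem_maxPartition {a : V} {H : Set V}
    (hH : H ∈ MaxPartition (initialSegments V) (Set.Iic a)) (hne : H ≠ {a}) :
    ∃ b < a, H = Set.Iic b := by
  obtain ⟨⟨v, rfl⟩ | ⟨b, rfl⟩, hsub, hmax⟩ := hH
  · have hva : v < a := lt_of_le_of_ne (hsub.1 rfl) fun h => hne (by rw [h])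
    refine ⟨v, hva, by_contra fun h => hmax ⟨Set.Iic v, .inr ⟨v, rfl⟩, ?_, ?_⟩⟩
    · exact (Set.singleton_subset_iff.2 (Set.mem_Iic.2 le_rfl)).ssubset_of_ne h
    · exact Set.Iic_ssubset_Iic.2 hva
  · exact ⟨b, Set.Iic_ssubset_Iic.1 hsub, rfl⟩

theorem ncard_maxPartition_Iic_le_two (a : V) :
    (MaxPartition (initialSegments V) (Set.Iic a)).ncard ≤ 2 := by
  set P := MaxPartition (initialSegments V) (Set.Iic a)
  have hsub : (P \ {{a}}).Subsingleton := by
    rintro H ⟨hH, hHa⟩ K ⟨hK, hKa⟩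
    obtain ⟨b, hb, rfl⟩ := eq_Iic_of_mem_maxPartition hH hHa
    obtain ⟨c, hc, rfl⟩ := eq_Iic_of_mem_maxPartition hK hKa
    rcases lt_trichotomy b c with h | rfl | h
    · exact absurd ⟨_, hK.1, Set.Iic_ssubset_Iic.2 h, hK.2.1⟩ hH.2.2
    · rfl
    · exact absurd ⟨_, hH.1, Set.Iic_ssubset_Iic.2 h, hH.2.1⟩ hK.2.2
  have h₁ : (P \ {{a}}).ncard ≤ 1 := (Set.ncard_le_one hsub.finite).2 fun x hx y hy => hsub hx hy
  have h₂ := Set.ncard_le_ncard_sdiff_add_ncard P {{a}} (Set.finite_singleton _)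
  rw [Set.ncard_singleton] at h₂
  lia

theorem ndWidth_initialSegments_le_two : NDWidth (initialSegments V) ≤ 2 := by
  refine ciSup_le' fun M => ciSup_le' fun hM => ?_
  obtain ⟨v, rfl⟩ | ⟨a, rfl⟩ := hM
  · have : MaxPartition (initialSegments V) {v} = ∅ := by
      refine Set.eq_empty_of_forall_notMem ?_
      rintro H ⟨hH, hsub, -⟩
      obtain rfl := Set.ssubset_singleton_iff.1 hsub
      obtain ⟨w, hw⟩ | ⟨b, hb⟩ := hH
      · exact Set.singleton_ne_empty w hw
      · exact Set.nonempty_Iic.ne_empty hb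
    simp [this]
  · exact ncard_maxPartition_Iic_le_two a

end LinearOrder

theorem exists_linearOrder_of_acyclic {E : V → V → Prop}
    (hacyc : ∀ v : V, ¬ Relation.TransGen E v v) :
    ∃ _ : LinearOrder V, ∀ u v, ReflTransGen E u v → u ≤ v := by
  let P : PartialOrder V :=
    { le := ReflTransGen E
      le_refl := fun _ => .refl
      le_trans := fun _ _ _ => .trans
      le_antisymm := fun a b hab hba => by
        rcases reflTransGen_iff_eq_or_transGen.1 hab with h | h
        · exact h.symm
        · exact absurd (h.trans_left hba) (hacyc a) }
  exact ⟨(inferInstance : LinearOrder (LinearExtension V)),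
    fun u v h => (toLinearExtension (α := V)).monotone h⟩

/-- if `E` admits no directed cycle and `|V| ≥ 2`, then the
nesting width of `G` is at most 2. -/
theorem nestingWidth_of_acyclic [Fintype V] (E : V → V → Prop) (s : V)
    (hreach : ∀ v : V, ∃ p : List V, IsPath E s v p)
    (hcard : 2 ≤ Fintype.card V)
    (hacyc : ∀ v : V, ¬ Relation.TransGen E v v) :
    nestingWidth E s ≤ 2 := by
  obtain ⟨_, hle⟩ := exists_linearOrder_of_acyclic hacyc
  have hF : IsNestingDecomp E s (initialSegments V) :=
    isNestingDecomp_initialSegments (fun u v h => hle u v (.single h)) fun v =>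
      (hreach v).elim fun _ hp => hle s v hp.reflTransGen
  have hle_width : nestingWidth E s ≤ NDWidth (initialSegments V) := Nat.sInf_le ⟨_, hF, rfl⟩
  exact hle_width.trans ndWidth_initialSegments_le_two
end
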